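/- Littlewood's identity for even partitions: Σ_{λ even} s_λ(α_1,...,α_n) = ∏_{1 ≤ i ≤ j ≤ n} 1/(1 - α_i α_j), where the sum is over partitions λ with at most n parts all of which are even. -/

import Mathlib

open scoped Classical

noncomputable section

/-- Cells of the Young diagram of `f : Fin r → ℕ` (viewed as a partition with at most
`r` parts, row `i` having length `f i`). -/
def pcells {r : ℕ} (f : Fin r → ℕ) : Finset (Fin r × ℕ) :=
  (Finset.univ ×ˢ Finset.range (Finset.univ.sup f)).filter (fun p => p.2 < f p.1)

/-- `T` is a semistandard filling of the diagram of `f` with entries in `Fin n`: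
rows weakly increase, columns strictly increase. -/
def IsSSYT {r n : ℕ} (f : Fin r → ℕ) (T : {x // x ∈ pcells f} → Fin n) : Prop :=
  (∀ p q : {x // x ∈ pcells f},
      p.val.1 = q.val.1 → p.val.2 ≤ q.val.2 → T p ≤ T q) ∧
  (∀ p q : {x // x ∈ pcells f},
      p.val.2 = q.val.2 → p.val.1 < q.val.1 → T p < T q)

/-- The Schur polynomial `s_f(x_1, …, x_n)`, defined combinatorially as the sum over
semistandard Young tableaux of shape `f` with entries in `{1, …, n}` of their weights. -/
def schurPoly {r : ℕ} (f : Fin r → ℕ) (n : ℕ) : MvPolynomial (Fin n) ℤ :=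
  ∑ T ∈ Finset.univ.filter (fun T : {x // x ∈ pcells f} → Fin n => IsSSYT f T),
    ∏ c : {x // x ∈ pcells f}, MvPolynomial.X (T c)

/-- The `j`-th part (`j` counted from `0`) of the conjugate of the partition `f`. -/
def conjPart {r : ℕ} (f : Fin r → ℕ) (j : ℕ) : ℕ :=
  (Finset.univ.filter (fun i => j < f i)).card

/-- The finset of partitions with at most `n` parts and size at most `m`. -/
def partitionsLE (n m : ℕ) : Finset (Fin n → ℕ) :=
  (Fintype.piFinset fun _ => Finset.range (m + 1)).filter
    (fun f => (∀ i j : Fin n, i ≤ j → f j ≤ f i) ∧ ∑ i, f i ≤ m)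

/-- `μ` interlaces `f`, that is, `f / μ` is a horizontal strip. -/
def Interlaces (μ f : ℕ → ℕ) : Prop := ∀ i, f (i + 1) ≤ μ i ∧ μ i ≤ f i

/-- Gelfand–Tsetlin patterns with `n` rows and top row `f`. -/
def GTPattern : ℕ → (ℕ → ℕ) → Type
  | 0, f => PLift (f = 0)
  | n + 1, f => Σ μ : {μ : ℕ → ℕ // Interlaces μ f}, GTPattern n μ.1

/-- The size of the first `n` parts of `f`. -/
def psize (n : ℕ) (f : ℕ → ℕ) : ℕ := ∑ i ∈ Finset.range n, f i

/-- The weight of a Gelfand–Tsetlin pattern: the letter `v k` is counted once for each cell in the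
difference of the rows `k` and `k + 1`. -/
def GTPattern.weight {M : Type*} [AddCommMonoid M] (v : ℕ → M) :
    ∀ {n : ℕ} {f : ℕ → ℕ}, GTPattern n f → M
  | 0, _, _ => 0
  | n + 1, f, ⟨μ, g⟩ => GTPattern.weight v (n := n) g + (psize (n + 1) f - psize n μ.1) • v n

theorem GTPattern.eq_zero : ∀ {n : ℕ} {f : ℕ → ℕ}, GTPattern n f → ∀ i, n ≤ i → f i = 0
  | 0, _, ⟨h⟩, i, _ => congrFun h i
  | n + 1, f, ⟨μ, g⟩, i, hi => by
    obtain ⟨j, rfl⟩ : ∃ j, i = j + 1 := ⟨i - 1, by omega⟩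
    have := GTPattern.eq_zero (n := n) g j (by omega)
    have := (μ.2 j).1
    omega

theorem GTPattern.antitone : ∀ {n : ℕ} {f : ℕ → ℕ}, GTPattern n f → Antitone f
  | 0, _, ⟨h⟩ => by subst h; exact antitone_const
  | _ + 1, _, ⟨μ, _⟩ => antitone_nat_of_succ_le fun i => (μ.2 i).1.trans (μ.2 i).2

/-- The sequence `a, f 0, f 1, …`. -/
def consSeq (a : ℕ) (f : ℕ → ℕ) : ℕ → ℕ
  | 0 => a
  | i + 1 => f i

/-- The shapes above both `ρ` and `ν` correspond to the shapes below both, together with a number,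
by reflecting each part in the interval it is confined to. -/
def aboveEquivBelow (ρ ν : ℕ → ℕ) :
    {μ : ℕ → ℕ // Interlaces ρ μ ∧ Interlaces ν μ} ≃
      ℕ × {κ : ℕ → ℕ // Interlaces κ ρ ∧ Interlaces κ ν} where
  toFun μ := (μ.1 0 - max (ρ 0) (ν 0),
    ⟨fun i => max (ρ (i + 1)) (ν (i + 1)) + min (ρ i) (ν i) - μ.1 (i + 1), by
      constructor <;> intro i <;> dsimp only <;> have := μ.2.1 i <;> have := μ.2.2 i <;>
        have := μ.2.1 (i + 1) <;> have := μ.2.2 (i + 1) <;> omega⟩)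
  invFun x := ⟨consSeq (max (ρ 0) (ν 0) + x.1) fun i =>
      max (ρ (i + 1)) (ν (i + 1)) + min (ρ i) (ν i) - x.2.1 i, by
    constructor <;> rintro (_ | i) <;> dsimp only [consSeq]
    · have := x.2.2.1 0; have := x.2.2.2 0; omega
    · have := x.2.2.1 i; have := x.2.2.2 i
      have := x.2.2.1 (i + 1); have := x.2.2.2 (i + 1); omega
    · have := x.2.2.1 0; have := x.2.2.2 0; omega
    · have := x.2.2.1 i; have := x.2.2.2 i
      have := x.2.2.1 (i + 1); have := x.2.2.2 (i + 1); omega⟩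
  left_inv μ := by
    ext (_ | i) <;> dsimp only [consSeq]
    · have := μ.2.1 0; have := μ.2.2 0; omega
    · have := μ.2.1 i; have := μ.2.2 i
      have := μ.2.1 (i + 1); have := μ.2.2 (i + 1); omega
  right_inv x := by
    refine Prod.ext ?_ (Subtype.ext (funext fun i => ?_)) <;> dsimp only [consSeq]
    · omega
    · have := x.2.2.1 i; have := x.2.2.2 i; omega

theorem psize_add_psize_of_aboveEquivBelow {m : ℕ} {ρ ν : ℕ → ℕ} (hρ : ρ m = 0)
    (μ : {μ : ℕ → ℕ // Interlaces ρ μ ∧ Interlaces ν μ}) :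
    psize (m + 1) μ.1 + psize m (aboveEquivBelow ρ ν μ).2.1 =
      (aboveEquivBelow ρ ν μ).1 + psize (m + 1) ν + psize m ρ := by
  have h0 : psize (m + 1) ν + psize m ρ =
      ∑ i ∈ Finset.range (m + 1), (max (ρ i) (ν i)) + ∑ i ∈ Finset.range m, min (ρ i) (ν i) := by
    rw [← add_zero (∑ i ∈ Finset.range m, min (ρ i) (ν i)),
      show 0 = min (ρ m) (ν m) by omega,
      ← Finset.sum_range_succ (fun i => min (ρ i) (ν i)), ← Finset.sum_add_distrib,
      psize, psize, ← add_zero (∑ i ∈ Finset.range m, ρ i), ← hρ, ← Finset.sum_range_succ,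
      ← Finset.sum_add_distrib]
    exact Finset.sum_congr rfl fun i _ => by omega
  rw [add_assoc, h0, psize, psize, Finset.sum_range_succ', Finset.sum_range_succ' (fun i => max _ _),
    add_right_comm, add_right_comm _ _ (∑ i ∈ Finset.range m, min (ρ i) (ν i)),
    ← Finset.sum_add_distrib, ← Finset.sum_add_distrib, add_left_comm]
  refine congrArg₂ _ (Finset.sum_congr rfl fun i _ => ?_) ?_
  · simp only [aboveEquivBelow, Equiv.coe_fn_mk]
    have := μ.2.1 i; have := μ.2.2 i; have := μ.2.1 (i + 1); have := μ.2.2 (i + 1); omega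
  · simp only [aboveEquivBelow, Equiv.coe_fn_mk]
    have := μ.2.1 0; have := μ.2.2 0; omega

/-- The even shapes above `μ` correspond to the even shapes below `μ`, together with a number,
by reflecting each part in the interval it is confined to. -/
def evenAboveEquivBelow (μ : ℕ → ℕ) :
    {l : ℕ → ℕ // Interlaces μ l ∧ ∀ i, Even (l i)} ≃
      ℕ × {ν : ℕ → ℕ // Interlaces ν μ ∧ ∀ i, Even (ν i)} where
  toFun l := ((l.1 0 - μ 0) / 2,
    ⟨fun i => μ (i + 1) + μ (i + 1) % 2 + (μ i - μ i % 2) - l.1 (i + 1), by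
      constructor <;> intro i <;> dsimp only <;> have := l.2.1 i <;>
        have := l.2.1 (i + 1) <;> have := l.2.2 (i + 1) <;> grind⟩)
  invFun x := ⟨consSeq (μ 0 + μ 0 % 2 + 2 * x.1) fun i =>
      μ (i + 1) + μ (i + 1) % 2 + (μ i - μ i % 2) - x.2.1 i, by
    constructor <;> rintro (_ | i) <;> dsimp only [consSeq]
    · have := x.2.2.1 0; have := x.2.2.2 0; grind
    · have := x.2.2.1 i; have := x.2.2.2 i
      have := x.2.2.1 (i + 1); have := x.2.2.2 (i + 1); grind
    · have := x.2.2.1 0; have := x.2.2.2 0; grind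
    · have := x.2.2.1 i; have := x.2.2.2 i; grind⟩
  left_inv l := by
    ext (_ | i) <;> dsimp only [consSeq]
    · have := l.2.1 0; have := l.2.2 0; grind
    · have := l.2.1 i
      have := l.2.1 (i + 1); have := l.2.2 (i + 1); grind
  right_inv x := by
    refine Prod.ext ?_ (Subtype.ext (funext fun i => ?_)) <;> dsimp only [consSeq]
    · omega
    · have := x.2.2.1 i; have := x.2.2.2 i; grind

theorem psize_add_psize_of_evenAboveEquivBelow {m : ℕ} {μ : ℕ → ℕ} (hμ : μ m = 0)
    (l : {l : ℕ → ℕ // Interlaces μ l ∧ ∀ i, Even (l i)}) :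
    psize (m + 1) l.1 + psize m (evenAboveEquivBelow μ l).2.1 =
      2 * (evenAboveEquivBelow μ l).1 + psize m μ + psize m μ := by
  have h0 : psize m μ + psize m μ =
      ∑ i ∈ Finset.range (m + 1), (μ i + μ i % 2) + ∑ i ∈ Finset.range m, (μ i - μ i % 2) := by
    rw [Finset.sum_range_succ, hμ, psize, ← Finset.sum_add_distrib, add_right_comm,
      ← Finset.sum_add_distrib]
    simp only [Nat.zero_mod, add_zero]
    exact Finset.sum_congr rfl fun i _ => by omega
  rw [add_assoc, h0, psize, psize, Finset.sum_range_succ', Finset.sum_range_succ' (fun i => _ + _),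
    add_right_comm, add_right_comm _ _ (∑ i ∈ Finset.range m, (μ i - μ i % 2)),
    ← Finset.sum_add_distrib, ← Finset.sum_add_distrib, add_left_comm]
  refine congrArg₂ _ (Finset.sum_congr rfl fun i _ => ?_) ?_
  · simp only [evenAboveEquivBelow, Equiv.coe_fn_mk]
    have := l.2.1 i; have := l.2.1 (i + 1); have := l.2.2 (i + 1); grind
  · simp only [evenAboveEquivBelow, Equiv.coe_fn_mk]
    have := l.2.1 0; have := l.2.2 0; grind

/-- Tuples of `m` multiplicities. -/
def Mults : ℕ → Type
  | 0 => Unit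
  | m + 1 => ℕ × Mults m

/-- The weight of a tuple of multiplicities of the vectors `u 0, …, u (m - 1)`. -/
def Mults.weight {M : Type*} [AddCommMonoid M] (u : ℕ → M) : ∀ {m : ℕ}, Mults m → M
  | 0, _ => 0
  | m + 1, ⟨k, c⟩ => k • u m + Mults.weight u (m := m) c

theorem psize_le_of_interlaces {m : ℕ} {μ f : ℕ → ℕ} (h : Interlaces μ f) :
    psize m μ ≤ psize m f :=
  Finset.sum_le_sum fun i _ => (h i).2

theorem psize_le_succ (m : ℕ) (f : ℕ → ℕ) : psize m f ≤ psize (m + 1) f := by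
  simp [psize, Finset.sum_range_succ]

/-- The Pieri rule: multiplying by all complete homogeneous polynomials. -/
theorem exists_pieri_equiv {M : Type*} [AddCommMonoid M] (v : ℕ → M) (t : M) (m : ℕ) :
    ∀ ν : ℕ → ℕ, ∃ e : (Σ μ : {μ : ℕ → ℕ // Interlaces ν μ}, GTPattern m μ.1) ≃
        Mults m × GTPattern m ν,
      ∀ x, Mults.weight (fun i => v i + t) (e x).1 + (e x).2.weight v =
        x.2.weight v + (psize m x.1.1 - psize m ν) • t := by
  induction m with
  | zero =>
    intro ν
    refine ⟨⟨fun x => ((), ⟨funext fun i => ?_⟩), fun x => ⟨⟨0, ?_⟩, ⟨rfl⟩⟩, ?_, ?_⟩, ?_⟩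
    · have := x.2.eq_zero i (Nat.zero_le _)
      have := (x.1.2 i).2
      simp; omega
    · obtain rfl : ν = 0 := x.2.down
      exact fun i => ⟨le_rfl, le_rfl⟩
    · rintro ⟨⟨μ, h⟩, ⟨h'⟩⟩
      obtain rfl : μ = 0 := h'
      rfl
    · rintro ⟨⟨⟩, ⟨h⟩⟩
      rfl
    · rintro ⟨⟨μ, h⟩, ⟨h'⟩⟩
      simp [Mults.weight, GTPattern.weight, psize]
  | succ m ih =>
    intro ν
    choose e he using ih
    let e₁ : (Σ μ : {μ : ℕ → ℕ // Interlaces ν μ}, GTPattern (m + 1) μ.1) ≃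
        Σ ρ : ℕ → ℕ, {μ : ℕ → ℕ // Interlaces ρ μ ∧ Interlaces ν μ} × GTPattern m ρ :=
      { toFun := fun x => ⟨x.2.1.1, ⟨x.1.1, x.2.1.2, x.1.2⟩, x.2.2⟩
        invFun := fun x => ⟨⟨x.2.1.1, x.2.1.2.2⟩, ⟨x.1, x.2.1.2.1⟩, x.2.2⟩
        left_inv := fun _ => rfl
        right_inv := fun _ => rfl }
    let e₂ : (Σ ρ : ℕ → ℕ, (ℕ × {κ : ℕ → ℕ // Interlaces κ ρ ∧ Interlaces κ ν}) × GTPattern m ρ) ≃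
        ℕ × Σ κ : {κ : ℕ → ℕ // Interlaces κ ν},
          Σ ρ : {ρ : ℕ → ℕ // Interlaces κ.1 ρ}, GTPattern m ρ.1 :=
      { toFun := fun x => (x.2.1.1, ⟨⟨x.2.1.2.1, x.2.1.2.2.2⟩, ⟨x.1, x.2.1.2.2.1⟩, x.2.2⟩)
        invFun := fun x => ⟨x.2.2.1.1, (x.1, ⟨x.2.1.1, x.2.2.1.2, x.2.1.2⟩), x.2.2.2⟩
        left_inv := fun _ => rfl
        right_inv := fun _ => rfl }
    let e₃ : (ℕ × Σ κ : {κ : ℕ → ℕ // Interlaces κ ν}, Mults m × GTPattern m κ.1) ≃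
        Mults (m + 1) × GTPattern (m + 1) ν :=
      { toFun := fun x => ((x.1, x.2.2.1), ⟨x.2.1, x.2.2.2⟩)
        invFun := fun x => (x.1.1, ⟨x.2.1, x.1.2, x.2.2⟩)
        left_inv := fun _ => rfl
        right_inv := fun _ => rfl }
    refine ⟨((e₁.trans (Equiv.sigmaCongrRight fun ρ =>
      (aboveEquivBelow ρ ν).prodCongr (Equiv.refl _))).trans e₂).trans
      (((Equiv.refl ℕ).prodCongr (Equiv.sigmaCongrRight
        fun κ : {κ : ℕ → ℕ // Interlaces κ ν} => e κ.1)).trans e₃), ?_⟩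
    rintro ⟨⟨μ, h⟩, ⟨⟨ρ, h'⟩, g⟩⟩
    have hs := psize_add_psize_of_aboveEquivBelow (g.eq_zero m le_rfl) ⟨μ, h', h⟩
    have hκ := (aboveEquivBelow ρ ν ⟨μ, h', h⟩).2.2
    have hw := he _ ⟨⟨ρ, hκ.1⟩, g⟩
    set k := (aboveEquivBelow ρ ν ⟨μ, h', h⟩).1
    set κ := (aboveEquivBelow ρ ν ⟨μ, h', h⟩).2.1
    change (k • (v m + t) + Mults.weight (fun i => v i + t) (e κ ⟨⟨ρ, hκ.1⟩, g⟩).1) +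
        ((e κ ⟨⟨ρ, hκ.1⟩, g⟩).2.weight v + (psize (m + 1) ν - psize m κ) • v m) =
      (g.weight v + (psize (m + 1) μ - psize m ρ) • v m) + (psize (m + 1) μ - psize (m + 1) ν) • t
    have h1 := psize_le_of_interlaces (m := m) hκ.1
    have h2 := (psize_le_of_interlaces (m := m) hκ.2).trans (psize_le_succ m ν)
    simp only at hs hw
    rw [show psize (m + 1) μ - psize m ρ = k + (psize (m + 1) ν - psize m κ) by omega,
      show psize (m + 1) μ - psize (m + 1) ν = k + (psize m ρ - psize m κ) by omega,
      add_smul, add_smul, smul_add]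
    calc _ = k • v m + k • t + (Mults.weight (fun i => v i + t) (e κ ⟨⟨ρ, hκ.1⟩, g⟩).1 +
        (e κ ⟨⟨ρ, hκ.1⟩, g⟩).2.weight v) + (psize (m + 1) ν - psize m κ) • v m := by abel
      _ = _ := by rw [hw]; abel

/-- Gelfand–Tsetlin patterns with `n` rows whose top row is even. -/
def EvenGTPattern (n : ℕ) : Type := Σ l : {l : ℕ → ℕ // ∀ i, Even (l i)}, GTPattern n l.1

theorem exists_evenGTPattern_succ_equiv {M : Type*} [AddCommMonoid M] (v : ℕ → M) (n : ℕ) :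
    ∃ e : EvenGTPattern (n + 1) ≃ ℕ × (Mults n × EvenGTPattern n),
      ∀ x, (e x).1 • (v n + v n) + (Mults.weight (fun i => v i + v n) (e x).2.1 +
        (e x).2.2.2.weight v) = x.2.weight v := by
  choose e he using exists_pieri_equiv v (v n) n
  let e₁ : EvenGTPattern (n + 1) ≃
      Σ μ : ℕ → ℕ, {l : ℕ → ℕ // Interlaces μ l ∧ ∀ i, Even (l i)} × GTPattern n μ :=
    { toFun := fun x => ⟨x.2.1.1, ⟨x.1.1, x.2.1.2, x.1.2⟩, x.2.2⟩
      invFun := fun x => ⟨⟨x.2.1.1, x.2.1.2.2⟩, ⟨x.1, x.2.1.2.1⟩, x.2.2⟩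
      left_inv := fun _ => rfl
      right_inv := fun _ => rfl }
  let e₂ : (Σ μ : ℕ → ℕ, (ℕ × {ν : ℕ → ℕ // Interlaces ν μ ∧ ∀ i, Even (ν i)}) × GTPattern n μ) ≃
      ℕ × Σ ν : {ν : ℕ → ℕ // ∀ i, Even (ν i)},
        Σ μ : {μ : ℕ → ℕ // Interlaces ν.1 μ}, GTPattern n μ.1 :=
    { toFun := fun x => (x.2.1.1, ⟨⟨x.2.1.2.1, x.2.1.2.2.2⟩, ⟨x.1, x.2.1.2.2.1⟩, x.2.2⟩)
      invFun := fun x => ⟨x.2.2.1.1, (x.1, ⟨x.2.1.1, x.2.2.1.2, x.2.1.2⟩), x.2.2.2⟩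
      left_inv := fun _ => rfl
      right_inv := fun _ => rfl }
  let e₃ : (ℕ × Σ ν : {ν : ℕ → ℕ // ∀ i, Even (ν i)}, Mults n × GTPattern n ν.1) ≃
      ℕ × (Mults n × EvenGTPattern n) :=
    { toFun := fun x => (x.1, (x.2.2.1, ⟨x.2.1, x.2.2.2⟩))
      invFun := fun x => (x.1, ⟨x.2.2.1, x.2.1, x.2.2.2⟩)
      left_inv := fun _ => rfl
      right_inv := fun _ => rfl }
  refine ⟨((e₁.trans (Equiv.sigmaCongrRight fun μ =>
    (evenAboveEquivBelow μ).prodCongr (Equiv.refl _))).trans e₂).trans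
    (((Equiv.refl ℕ).prodCongr (Equiv.sigmaCongrRight
      fun ν : {ν : ℕ → ℕ // ∀ i, Even (ν i)} => e ν.1)).trans e₃), ?_⟩
  rintro ⟨⟨l, h⟩, ⟨⟨μ, h'⟩, g⟩⟩
  have hs := psize_add_psize_of_evenAboveEquivBelow (g.eq_zero n le_rfl) ⟨l, h', h⟩
  have hν := (evenAboveEquivBelow μ ⟨l, h', h⟩).2.2
  have hw := he _ ⟨⟨μ, hν.1⟩, g⟩
  set k := (evenAboveEquivBelow μ ⟨l, h', h⟩).1
  set ν := (evenAboveEquivBelow μ ⟨l, h', h⟩).2.1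
  change k • (v n + v n) + (Mults.weight (fun i => v i + v n) (e ν ⟨⟨μ, hν.1⟩, g⟩).1 +
    (e ν ⟨⟨μ, hν.1⟩, g⟩).2.weight v) = g.weight v + (psize (n + 1) l - psize n μ) • v n
  have h1 := psize_le_of_interlaces (m := n) hν.1
  simp only at hs hw
  rw [hw, show psize (n + 1) l - psize n μ = k + k + (psize n μ - psize n ν) by omega,
    add_smul, add_smul, smul_add]
  abel

/-- The generating series of a type weighted by monomials. -/
def genSeries {σ A : Type*} (w : A → σ →₀ ℕ) : MvPowerSeries σ ℤ :=
  fun d => (Nat.card {a // w a = d} : ℤ)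

theorem coeff_genSeries {σ A : Type*} (w : A → σ →₀ ℕ) (d : σ →₀ ℕ) :
    MvPowerSeries.coeff d (genSeries w) = (Nat.card {a // w a = d} : ℤ) := rfl

/-- `P` is inverse to the generating series of the weighted type `A`, all of whose weights have
finite multiplicity. -/
def IsGenInverse {σ A : Type*} (w : A → σ →₀ ℕ) (P : MvPowerSeries σ ℤ) : Prop :=
  (∀ d, Finite {a // w a = d}) ∧ P * genSeries w = 1

theorem IsGenInverse.congr {σ A B : Type*} {w : A → σ →₀ ℕ} {P : MvPowerSeries σ ℤ}
    (h : IsGenInverse w P) {w' : B → σ →₀ ℕ} (e : B ≃ A) (he : ∀ b, w (e b) = w' b) :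
    IsGenInverse w' P := by
  have e' (d : σ →₀ ℕ) : {b // w' b = d} ≃ {a // w a = d} :=
    e.subtypeEquiv fun b => by rw [he]
  refine ⟨fun d => ?_, ?_⟩
  · have := h.1 d
    exact Finite.of_equiv _ (e' d).symm
  · rw [← h.2]
    congr 1
    ext d
    rw [coeff_genSeries, coeff_genSeries, Nat.card_congr (e' d)]

theorem isGenInverse_of_unique {σ A : Type*} [Unique A] {w : A → σ →₀ ℕ} (hw : ∀ a, w a = 0) :
    IsGenInverse w 1 := by
  refine ⟨fun d => inferInstance, ?_⟩
  ext d
  rw [one_mul, coeff_genSeries, MvPowerSeries.coeff_one]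
  split_ifs with h
  · subst h
    have : Unique {a // w a = 0} := ⟨⟨⟨default, hw _⟩⟩, fun a => Subsingleton.elim _ _⟩
    simp
  · have : IsEmpty {a // w a = d} := ⟨fun a => h (a.2.symm.trans (hw _))⟩
    simp

theorem IsGenInverse.prod_nat {σ A : Type*} {w : A → σ →₀ ℕ} {P : MvPowerSeries σ ℤ}
    (h : IsGenInverse w P) {m : σ →₀ ℕ} (hm : m ≠ 0) :
    IsGenInverse (fun x : ℕ × A => x.1 • m + w x.2) ((1 - MvPowerSeries.monomial m 1) * P) := by
  have hfin (d : σ →₀ ℕ) : Finite {x : ℕ × A // x.1 • m + w x.2 = d} := by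
    have := h.1
    have : Finite (Set.Iic d) := Set.finite_Iic d
    refine Finite.of_injective (β := Σ e : Set.Iic d, {a // w a = e.1})
      (fun x => ⟨⟨w x.1.2, le_add_self.trans x.2.le⟩, ⟨x.1.2, rfl⟩⟩) ?_
    · rintro ⟨⟨k, a⟩, hx⟩ ⟨⟨l, b⟩, hy⟩ hxy
      have hab : a = b := congrArg (fun z => z.2.1) hxy
      subst hab
      have hkl : k • m = l • m := add_right_cancel (hx.trans hy.symm)
      obtain ⟨s, hs⟩ := Finsupp.ne_iff.1 hm
      have := DFunLike.congr_fun hkl s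
      simp only [Finsupp.smul_apply, smul_eq_mul] at this
      have := Nat.eq_of_mul_eq_mul_right (Nat.pos_of_ne_zero hs) this
      simp [this]
  refine ⟨hfin, ?_⟩
  suffices key : (1 - MvPowerSeries.monomial m 1) *
      genSeries (fun x : ℕ × A => x.1 • m + w x.2) = genSeries w by
    rw [mul_right_comm, key, mul_comm, h.2]
  ext d
  rw [sub_mul, one_mul, map_sub, MvPowerSeries.coeff_monomial_mul, one_mul, coeff_genSeries,
    coeff_genSeries]
  have hd := h.1 d
  have hfd := hfin d
  have hfd' := hfin (d - m)
  let e : {x : ℕ × A // x.1 • m + w x.2 = d} ≃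
      {a // w a = d} ⊕ {x : ℕ × A // (x.1 + 1) • m + w x.2 = d} :=
    { toFun := fun
        | ⟨(0, a), h⟩ => Sum.inl ⟨a, by simpa using h⟩
        | ⟨(k + 1, a), h⟩ => Sum.inr ⟨(k, a), h⟩
      invFun := Sum.elim (fun a => ⟨(0, a.1), by simpa using a.2⟩) fun x => ⟨(x.1.1 + 1, x.1.2), x.2⟩
      left_inv := by rintro ⟨⟨_ | k, a⟩, h⟩ <;> rfl
      right_inv := by rintro (a | x) <;> rfl }
  have : Finite {x : ℕ × A // (x.1 + 1) • m + w x.2 = d} :=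
    Finite.of_injective (fun x => e.symm (Sum.inr x)) (e.symm.injective.comp Sum.inr_injective)
  rw [Nat.card_congr e, Nat.card_sum]
  split_ifs with hmd
  · rw [coeff_genSeries, Nat.card_congr (Equiv.subtypeEquivRight fun x : ℕ × A => ?_)]
    · push_cast
      exact add_sub_cancel_right _ _
    · rw [eq_tsub_iff_add_eq_of_le hmd, succ_nsmul, add_right_comm]
  · have : IsEmpty {x : ℕ × A // (x.1 + 1) • m + w x.2 = d} := ⟨fun x => hmd <| by
      rw [← x.2, succ_nsmul, add_right_comm]
      exact le_add_self⟩
    simp [coeff_genSeries]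

theorem IsGenInverse.prod_mults {σ A : Type*} {w : A → σ →₀ ℕ} {P : MvPowerSeries σ ℤ}
    (h : IsGenInverse w P) (u : ℕ → σ →₀ ℕ) (m : ℕ) (hu : ∀ i < m, u i ≠ 0) :
    IsGenInverse (fun x : Mults m × A => Mults.weight u x.1 + w x.2)
      ((∏ i ∈ Finset.range m, (1 - MvPowerSeries.monomial (u i) 1)) * P) := by
  induction m with
  | zero =>
    rw [Finset.prod_range_zero, one_mul]
    exact h.congr (Equiv.punitProd A) fun b => (zero_add _).symm
  | succ m ih =>
    rw [Finset.prod_range_succ, mul_comm (∏ _ ∈ _, _), mul_assoc]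
    refine ((ih fun i hi => hu i (by omega)).prod_nat (hu m (by omega))).congr
      (Equiv.prodAssoc ℕ (Mults m) A) fun b => ?_
    exact (add_assoc _ _ _).symm

theorem isGenInverse_evenGTPattern {σ : Type*} (v : ℕ → σ →₀ ℕ) (n : ℕ) (hv : ∀ i < n, v i ≠ 0) :
    IsGenInverse (fun x : EvenGTPattern n => x.2.weight v)
      (∏ j ∈ Finset.range n, ∏ i ∈ Finset.range (j + 1),
        (1 - MvPowerSeries.monomial (v i + v j) 1)) := by
  induction n with
  | zero =>
    rw [Finset.prod_range_zero]
    have : Unique (EvenGTPattern 0) :=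
      ⟨⟨⟨⟨0, fun _ => Even.zero⟩, ⟨rfl⟩⟩⟩, by
        rintro ⟨⟨l, hl⟩, ⟨h⟩⟩
        obtain rfl : l = 0 := h
        rfl⟩
    exact isGenInverse_of_unique fun _ => rfl
  | succ n ih =>
    obtain ⟨e, he⟩ := exists_evenGTPattern_succ_equiv v n
    have hne : ∀ i < n + 1, v i + v n ≠ 0 := fun i hi h => hv i hi (add_eq_zero.1 h).1
    rw [Finset.prod_range_succ, Finset.prod_range_succ _ n, mul_comm, mul_comm (∏ _ ∈ _, _),
      mul_assoc]
    exact (((ih fun i hi => hv i (by omega)).prod_mults (fun i => v i + v n) n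
      fun i hi => hne i (by omega)).prod_nat (hne n (by omega))).congr e he

/-- `T` is a semistandard tableau of shape `f` with entries less than `n`, extended by the value `n`
outside of the shape. -/
structure IsTableau (n : ℕ) (f : ℕ → ℕ) (T : ℕ → ℕ → ℕ) : Prop where
  le : ∀ i j, T i j ≤ n
  lt_iff : ∀ i j, T i j < n ↔ j < f i
  row : ∀ i, Monotone (T i)
  col : ∀ i j, j < f (i + 1) → T i j < T (i + 1) j

theorem sigma_tableau_ext {n : ℕ} {f : ℕ → ℕ}
    {x y : Σ μ : {μ // Interlaces μ f}, {T // IsTableau n μ.1 T}}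
    (hμ_eq : x.1.1 = y.1.1) (hT_eq : x.2.1 = y.2.1) : x = y := by
  obtain ⟨⟨μ, hμ⟩, ⟨T, hT⟩⟩ := x
  obtain ⟨⟨μ', hμ'⟩, ⟨T', hT'⟩⟩ := y
  obtain rfl : μ = μ' := hμ_eq
  obtain rfl : T = T' := hT_eq
  rfl

/-- Removing the largest letter of a tableau. -/
def tableauSuccEquiv (n : ℕ) (f : ℕ → ℕ) :
    {T // IsTableau (n + 1) f T} ≃ Σ μ : {μ // Interlaces μ f}, {T // IsTableau n μ.1 T} :=
  have hex (T : {T // IsTableau (n + 1) f T}) (i : ℕ) : ∃ j, n ≤ T.1 i j :=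
    ⟨f i, by have := T.2.lt_iff i (f i); omega⟩
  have hfind (T : {T // IsTableau (n + 1) f T}) (i j : ℕ) : T.1 i j < n ↔ j < Nat.find (hex T i) := by
    rw [Nat.lt_find_iff]
    exact ⟨fun h k hk => not_le.2 ((T.2.row i hk).trans_lt h), fun h => not_le.1 (h j le_rfl)⟩
  { toFun := fun T => ⟨⟨fun i => Nat.find (hex T i), fun i => by
        constructor
        · by_contra! h
          have h1 := T.2.col i _ h
          have h2 := (T.2.lt_iff (i + 1) _).2 h
          have := Nat.find_spec (hex T i)
          omega
        · exact Nat.find_min' _ (by have := T.2.lt_iff i (f i); omega)⟩,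
      ⟨fun i j => min (T.1 i j) n, fun i j => min_le_right _ _,
        fun i j => by rw [← hfind T i j]; omega,
        fun i j k h => by have := T.2.row i h; omega,
        fun i j h => by
          have h1 := (hfind T (i + 1) j).2 h
          have h2 := T.2.col i j ((T.2.lt_iff _ _).1 (by omega))
          omega⟩⟩
    invFun := fun x => ⟨fun i j => x.2.1 i j + if f i ≤ j then 1 else 0,
      fun i j => by have := x.2.2.le i j; split_ifs <;> omega,
      fun i j => by
        have := x.2.2.le i j; have := x.2.2.lt_iff i j; have := x.1.2 i
        split_ifs <;> omega,
      fun i j k h => by have := x.2.2.row i h; split_ifs <;> omega,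
      fun i j h => by
        have := x.1.2 i
        have := x.2.2.lt_iff i j; have := x.2.2.lt_iff (i + 1) j
        have := x.2.2.col i j
        split_ifs <;> omega⟩
    left_inv := fun T => by
      ext i j
      have := T.2.le i j; have := T.2.lt_iff i j
      dsimp only
      split_ifs <;> omega
    right_inv := fun ⟨⟨μ, hμ⟩, ⟨T, hT⟩⟩ => by
      have h1 (i j : ℕ) : min (T i j + if f i ≤ j then 1 else 0) n = T i j := by
        have := hT.le i j; have := hT.lt_iff i j; have := hμ i
        dsimp only at *
        split_ifs <;> omega
      have h2 (i : ℕ) (h : ∃ j, n ≤ T i j + if f i ≤ j then 1 else 0) : Nat.find h = μ i := by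
        rw [Nat.find_eq_iff]
        have h3 (j : ℕ) : n ≤ (T i j + if f i ≤ j then 1 else 0) ↔ μ i ≤ j := by
          have := h1 i j; have := hT.lt_iff i j
          dsimp only at *
          omega
        exact ⟨(h3 _).2 le_rfl, fun k hk => by rw [h3]; omega⟩
      exact sigma_tableau_ext (funext fun i => h2 i _) (funext₂ h1) }

theorem min_tableau_eq (n : ℕ) (f : ℕ → ℕ) (T : {T // IsTableau (n + 1) f T}) (i j : ℕ) :
    (tableauSuccEquiv n f T).2.1 i j = min (T.1 i j) n := rfl

/-- The sum of the weights of the entries of a tableau. -/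
def tableauWeight {M : Type*} [AddCommMonoid M] (v : ℕ → M) (n : ℕ) (f : ℕ → ℕ)
    (T : ℕ → ℕ → ℕ) : M :=
  ∑ i ∈ Finset.range n, ∑ j ∈ Finset.range (f i), v (T i j)

theorem exists_tableau_equiv_gtPattern {M : Type*} [AddCommMonoid M] (v : ℕ → M) (n : ℕ) :
    ∀ f : ℕ → ℕ, ∃ e : {T // IsTableau n f T} ≃ GTPattern n f,
      ∀ T, (e T).weight v = tableauWeight v n f T.1 := by
  induction n with
  | zero =>
    intro f
    refine ⟨⟨fun T => ⟨funext fun i => ?_⟩, fun h => ⟨0, ?_⟩, fun T => ?_, fun _ => rfl⟩, fun T => ?_⟩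
    · have := T.2.lt_iff i 0
      simp; omega
    · obtain rfl : f = 0 := h.down
      exact ⟨by simp, by simp, fun _ => monotone_const, by simp⟩
    · ext i j
      have := T.2.le i j
      simp; omega
    · simp [GTPattern.weight, tableauWeight]
  | succ n ih =>
    intro f
    choose e he using ih
    refine ⟨(tableauSuccEquiv n f).trans (Equiv.sigmaCongrRight fun μ => e μ.1), fun T => ?_⟩
    have hmin := min_tableau_eq n f T
    change (e _ (tableauSuccEquiv n f T).2).weight v +
      (psize (n + 1) f - psize n (tableauSuccEquiv n f T).1.1) • v n = _
    rw [he]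
    generalize tableauSuccEquiv n f T = x at hmin ⊢
    obtain ⟨⟨μ, hμ⟩, T', hT'⟩ := x
    have hμn : μ n = 0 := (e μ ⟨T', hT'⟩).eq_zero n le_rfl
    dsimp only at hmin hT' ⊢
    have hrow (i : ℕ) : ∑ j ∈ Finset.range (f i), v (T.1 i j) =
        ∑ j ∈ Finset.range (μ i), v (T' i j) + (f i - μ i) • v n := by
      rw [Finset.range_eq_Ico, ← Finset.sum_Ico_consecutive _ (Nat.zero_le _) (hμ i).2,
        ← Finset.range_eq_Ico]
      congr 1
      · refine Finset.sum_congr rfl fun j hj => ?_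
        have := hmin i j
        have := (hT'.lt_iff i j).2 (Finset.mem_range.1 hj)
        congr 1
        omega
      · rw [← Nat.card_Ico, ← Finset.sum_const]
        refine Finset.sum_congr rfl fun j hj => ?_
        have := hmin i j
        have := hT'.lt_iff i j
        have := (T.2.lt_iff i j)
        rw [Finset.mem_Ico] at hj
        congr 1
        omega
    have hps : psize n μ = ∑ i ∈ Finset.range (n + 1), μ i := by
      rw [Finset.sum_range_succ, hμn, add_zero, psize]
    rw [tableauWeight, tableauWeight, Finset.sum_congr rfl fun i _ => hrow i,
      Finset.sum_add_distrib, Finset.sum_range_succ, hμn, Finset.range_zero, Finset.sum_empty,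
      add_zero, ← Finset.sum_smul, Finset.sum_tsub_distrib _ fun i _ => (hμ i).2, ← hps, psize]

/-- Extension of a finite sequence by zero. -/
def extendZero {n : ℕ} (κ : Fin n → ℕ) (i : ℕ) : ℕ := if h : i < n then κ ⟨i, h⟩ else 0

theorem extendZero_of_lt {n : ℕ} (κ : Fin n → ℕ) {i : ℕ} (h : i < n) :
    extendZero κ i = κ ⟨i, h⟩ := dif_pos h

theorem extendZero_val {n : ℕ} (κ : Fin n → ℕ) (i : Fin n) : extendZero κ i = κ i :=
  extendZero_of_lt κ i.2

theorem extendZero_restrict {n : ℕ} {f : ℕ → ℕ} (hf : ∀ i, n ≤ i → f i = 0) :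
    extendZero (fun i : Fin n => f i) = f := by
  ext i
  unfold extendZero
  split_ifs with h
  · rfl
  · exact (hf i (by omega)).symm

theorem lt_of_lt_extendZero {n : ℕ} {κ : Fin n → ℕ} {i j : ℕ} (h : j < extendZero κ i) : i < n := by
  unfold extendZero at h
  split_ifs at h with h'
  · exact h'
  · omega

theorem mem_pcells {r : ℕ} {f : Fin r → ℕ} {p : Fin r × ℕ} : p ∈ pcells f ↔ p.2 < f p.1 := by
  simp only [pcells, Finset.mem_filter, Finset.mem_product, Finset.mem_univ, Finset.mem_range,
    true_and, and_iff_right_iff_imp]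
  exact fun h => h.trans_le (Finset.le_sup (Finset.mem_univ p.1))

theorem mk_mem_pcells {n : ℕ} {κ : Fin n → ℕ} {i j : ℕ} (h : j < extendZero κ i) :
    ((⟨i, lt_of_lt_extendZero h⟩, j) : Fin n × ℕ) ∈ pcells κ := by
  rw [mem_pcells]
  rwa [extendZero_of_lt _ (lt_of_lt_extendZero h)] at h

theorem lt_extendZero {n : ℕ} {κ : Fin n → ℕ} (p : {x // x ∈ pcells κ}) :
    p.1.2 < extendZero κ p.1.1 := by
  rw [extendZero_val]
  exact mem_pcells.1 p.2

theorem sum_pcells {M : Type*} [AddCommMonoid M] {n : ℕ} (κ : Fin n → ℕ) (F : ℕ → ℕ → M) :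
    ∑ c : {x // x ∈ pcells κ}, F c.1.1 c.1.2 =
      ∑ i ∈ Finset.range n, ∑ j ∈ Finset.range (extendZero κ i), F i j := by
  rw [Finset.sum_coe_sort (pcells κ) fun p => F p.1 p.2,
    Finset.sum_finset_product (pcells κ) Finset.univ (fun i => Finset.range (κ i))
      (fun p => by simp [mem_pcells]), Finset.sum_range]
  exact Finset.sum_congr rfl fun i _ => by rw [extendZero_val]

/-- The extension of a filling with entries less than `n` by the value `n`. -/
def extendFilling {n : ℕ} {κ : Fin n → ℕ} (T : {x // x ∈ pcells κ} → Fin n) (i j : ℕ) : ℕ :=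
  if h : j < extendZero κ i then T ⟨_, mk_mem_pcells h⟩ else n

theorem extendFilling_cell {n : ℕ} {κ : Fin n → ℕ} (T : {x // x ∈ pcells κ} → Fin n)
    (c : {x // x ∈ pcells κ}) : extendFilling T c.1.1 c.1.2 = T c :=
  dif_pos (lt_extendZero c)

/-- The two descriptions of semistandard tableaux agree. -/
def ssytEquiv {n : ℕ} (κ : Fin n → ℕ) (hκ : Antitone κ) :
    {T : {x // x ∈ pcells κ} → Fin n // IsSSYT κ T} ≃ {T // IsTableau n (extendZero κ) T} where
  toFun T := ⟨extendFilling T.1,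
    fun i j => by unfold extendFilling; split_ifs <;> omega,
    fun i j => by unfold extendFilling; split_ifs <;> omega,
    fun i j k h => by
      unfold extendFilling
      split_ifs
      · exact T.2.1 _ _ rfl h
      all_goals omega,
    fun i j h => by
      have h' : j < extendZero κ i := h.trans_le <| by
        have := lt_of_lt_extendZero h
        rw [extendZero_of_lt κ this, extendZero_of_lt κ (by omega : i < n)]
        exact hκ (by simp)
      rw [extendFilling, extendFilling, dif_pos h, dif_pos h']
      exact T.2.2 _ _ rfl (by simp)⟩
  invFun T := ⟨fun c => ⟨T.1 c.1.1 c.1.2, (T.2.lt_iff _ _).2 (lt_extendZero c)⟩, by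
    constructor
    · rintro ⟨⟨i, j⟩, h⟩ ⟨⟨i', j'⟩, h'⟩ rfl hj
      exact T.2.row i hj
    · rintro ⟨⟨i, j⟩, h⟩ ⟨⟨i', j'⟩, h'⟩ rfl hi
      have key (k : ℕ) (hk : i < k) (hkj : j < extendZero κ k) : T.1 i j < T.1 k j := by
        induction k, hk using Nat.le_induction with
        | base => exact T.2.col i j hkj
        | succ k hk ih =>
          have h1 := T.2.col k j hkj
          have h2 := (T.2.lt_iff _ _).2 hkj
          exact (ih ((T.2.lt_iff _ _).1 (by omega))).trans h1
      exact key i' hi (lt_extendZero ⟨_, h'⟩)⟩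
  left_inv T := Subtype.ext <| funext fun c => Fin.ext <| extendFilling_cell T.1 c
  right_inv T := by
    ext i j
    dsimp only
    unfold extendFilling
    split_ifs with h
    · rfl
    · have := T.2.lt_iff i j
      have := T.2.le i j
      omega

theorem tableauWeight_ssytEquiv {M : Type*} [AddCommMonoid M] (v : ℕ → M) {n : ℕ} (κ : Fin n → ℕ)
    (hκ : Antitone κ) (T : {T : {x // x ∈ pcells κ} → Fin n // IsSSYT κ T}) :
    tableauWeight v n (extendZero κ) (ssytEquiv κ hκ T).1 = ∑ c, v (T.1 c) := by
  rw [tableauWeight, ← sum_pcells κ fun i j => v ((ssytEquiv κ hκ T).1 i j)]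
  exact Finset.sum_congr rfl fun c _ => congrArg v (extendFilling_cell T.1 c)

theorem coeff_schurPoly {r : ℕ} (f : Fin r → ℕ) (n : ℕ) (d : Fin n →₀ ℕ) :
    MvPolynomial.coeff d (schurPoly f n) =
      (Nat.card {T : {T : {x // x ∈ pcells f} → Fin n // IsSSYT f T} //
        ∑ c, Finsupp.single (T.1 c) 1 = d} : ℤ) := by
  have hX (T : {x // x ∈ pcells f} → Fin n) :
      ∏ c, (MvPolynomial.X (T c) : MvPolynomial (Fin n) ℤ) =
        MvPolynomial.monomial (∑ c, Finsupp.single (T c) 1) 1 := by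
    rw [MvPolynomial.monomial_sum_one]
    rfl
  simp only [schurPoly, MvPolynomial.coeff_sum, hX, MvPolynomial.coeff_monomial]
  rw [Finset.sum_boole, Finset.filter_filter,
    Nat.card_congr (Equiv.subtypeSubtypeEquivSubtypeInter (IsSSYT f)
      fun T => ∑ c, Finsupp.single (T c) 1 = d), Nat.card_eq_fintype_card, Fintype.card_subtype]

theorem sum_eq_of_sum_single_eq {n : ℕ} {κ : Fin n → ℕ} {T : {x // x ∈ pcells κ} → Fin n}
    {d : Fin n →₀ ℕ} (h : ∑ c, Finsupp.single (T c) 1 = d) : ∑ i, κ i = ∑ i, d i := by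
  have h1 : ∑ i, d i = Fintype.card {x // x ∈ pcells κ} := by
    rw [← h]
    simp only [Finsupp.coe_finsetSum, Finset.sum_apply]
    rw [Finset.sum_comm]
    simp [Finsupp.single_apply]
  have h2 := sum_pcells κ fun _ _ => 1
  rw [Finset.sum_range] at h2
  simp only [extendZero_val, Finset.sum_const, Finset.card_range, smul_eq_mul, mul_one,
    Finset.card_univ] at h2
  rw [h1, h2]

theorem sum_coeff_schurPoly (n : ℕ) (v : ℕ → Fin n →₀ ℕ)
    (hv : ∀ i : Fin n, v i = Finsupp.single i 1) (d : Fin n →₀ ℕ) :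
    ∑ κ ∈ (partitionsLE n (∑ i, d i)).filter (fun f => ∀ i : Fin n, Even (f i)),
        MvPolynomial.coeff d (schurPoly κ n) =
      (Nat.card {x : EvenGTPattern n // x.2.weight v = d} : ℤ) := by
  choose e he using exists_tableau_equiv_gtPattern v n
  have hmem (κ : Fin n → ℕ) : κ ∈ (partitionsLE n (∑ i, d i)).filter
      (fun f => ∀ i : Fin n, Even (f i)) ↔
      (Antitone κ ∧ ∑ i, κ i ≤ ∑ i, d i) ∧ ∀ i, Even (κ i) := by
    simp only [partitionsLE, Finset.mem_filter, Fintype.mem_piFinset, Finset.mem_range]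
    refine and_congr_left fun _ => ⟨fun h => ⟨fun i j hij => h.2.1 i j hij, h.2.2⟩, fun h =>
      ⟨fun i => Nat.lt_succ_of_le ?_, fun i j hij => h.1 hij, h.2⟩⟩
    exact (Finset.single_le_sum (fun _ _ => Nat.zero_le _) (Finset.mem_univ i)).trans h.2
  generalize (partitionsLE n (∑ i, d i)).filter (fun f => ∀ i : Fin n, Even (f i)) = S at hmem ⊢
  have hw (κ : Fin n → ℕ) (hκ : Antitone κ) (T : {T : {x // x ∈ pcells κ} → Fin n // IsSSYT κ T}) :
      (e _ (ssytEquiv κ hκ T)).weight v = ∑ c, Finsupp.single (T.1 c) 1 := by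
    rw [he, tableauWeight_ssytEquiv]
    simp only [hv]
  let F : (Σ κ : S, {T : {T : {x // x ∈ pcells κ.1} → Fin n // IsSSYT κ.1 T} //
      ∑ c, Finsupp.single (T.1 c) 1 = d}) → {x : EvenGTPattern n // x.2.weight v = d} :=
    fun x => ⟨⟨⟨extendZero x.1.1, fun i => by
      unfold extendZero
      split_ifs
      · exact ((hmem _).1 x.1.2).2 _
      · exact Even.zero⟩, e _ (ssytEquiv x.1.1 ((hmem _).1 x.1.2).1.1 x.2.1)⟩,
      (hw _ _ _).trans x.2.2⟩
  have hF : Function.Bijective F := by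
    constructor
    · rintro ⟨⟨κ, hκ⟩, ⟨T, hT⟩⟩ ⟨⟨κ', hκ'⟩, ⟨T', hT'⟩⟩ h
      obtain rfl : κ = κ' := funext fun i => by
        have := congrArg (fun x => x.1.1.1 i) h
        simpa only [F, extendZero_val] using this
      have h1 := eq_of_heq (Sigma.mk.inj (Subtype.mk.inj h)).2
      obtain rfl := (ssytEquiv κ _).injective ((e _).injective h1)
      rfl
    · rintro ⟨⟨⟨l, hl⟩, g⟩, hg⟩
      obtain ⟨κ, rfl⟩ : ∃ κ : Fin n → ℕ, extendZero κ = l := ⟨_, extendZero_restrict g.eq_zero⟩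
      have hκ : Antitone κ := fun i j hij => by
        simpa only [extendZero_val] using g.antitone (Fin.le_def.1 hij)
      obtain ⟨T, rfl⟩ := ((ssytEquiv κ hκ).trans (e _)).surjective g
      have hT := (hw κ hκ T).symm.trans hg
      exact ⟨⟨⟨κ, (hmem κ).2 ⟨⟨hκ, (sum_eq_of_sum_single_eq hT).le⟩, fun i => by
        simpa only [extendZero_val] using hl i⟩⟩, ⟨T, hT⟩⟩, rfl⟩
  rw [← Nat.card_eq_of_bijective F hF, Nat.card_sigma, ← Finset.sum_coe_sort S]
  push_cast
  exact Finset.sum_congr rfl fun κ _ => coeff_schurPoly κ.1 n d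

theorem prod_filter_le_eq_prod_range {M : Type*} [CommMonoid M] (n : ℕ) (F : ℕ → ℕ → M) :
    ∏ p ∈ Finset.univ.filter (fun p : Fin n × Fin n => p.1 ≤ p.2), F p.1 p.2 =
      ∏ j ∈ Finset.range n, ∏ i ∈ Finset.range (j + 1), F i j := by
  rw [Finset.prod_finset_product_right _ Finset.univ (fun j => Finset.Iic j) (fun p => by simp),
    Finset.prod_range]
  refine Finset.prod_congr rfl fun j _ => ?_
  rw [Nat.range_succ_eq_Iic, ← Fin.map_valEmbedding_Iic, Finset.prod_map]
  rfl

/-- Littlewood's identity for even partitions: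
`Σ_{λ even} s_λ(α_1,…,α_n) = ∏_{1 ≤ i ≤ j ≤ n} 1/(1 - α_i α_j)`,
stated as: the formal power series whose coefficients are those of the sum of the Schur
polynomials `s_λ(α_1,…,α_n)` over all partitions `λ` with at most `n` parts all of which
are even, is the inverse of `∏_{i≤j} (1 - α_i α_j)`. -/
theorem littlewood_even (n : ℕ) :
    (∏ p ∈ Finset.univ.filter (fun p : Fin n × Fin n => p.1 ≤ p.2),
        (1 - MvPowerSeries.X p.1 * MvPowerSeries.X p.2 : MvPowerSeries (Fin n) ℤ)) *
      (show MvPowerSeries (Fin n) ℤ from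
        fun d => ∑ κ ∈ (partitionsLE n (∑ i, d i)).filter
            (fun f => ∀ i : Fin n, Even (f i)),
          MvPolynomial.coeff d (schurPoly κ n)) = 1 := by
  have hv (i : Fin n) : (if h : (i : ℕ) < n then Finsupp.single ⟨i, h⟩ 1 else 0 : Fin n →₀ ℕ) =
      Finsupp.single i 1 := dif_pos i.2
  generalize hu : (fun i : ℕ => (if h : i < n then Finsupp.single ⟨i, h⟩ 1 else 0 : Fin n →₀ ℕ)) = v
  replace hv (i : Fin n) : v i = Finsupp.single i 1 := by rw [← hv, ← hu]
  have hv0 (i : ℕ) (hi : i < n) : v i ≠ 0 := by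
    rw [hv ⟨i, hi⟩]
    exact Finsupp.single_ne_zero.2 one_ne_zero
  refine Eq.trans ?_ (isGenInverse_evenGTPattern v n hv0).2
  rw [← prod_filter_le_eq_prod_range n fun i j => 1 - MvPowerSeries.monomial (v i + v j) (1 : ℤ)]
  congr 1
  · refine Finset.prod_congr rfl fun p _ => ?_
    rw [hv, hv, MvPowerSeries.X, MvPowerSeries.X, MvPowerSeries.monomial_mul_monomial, one_mul]
  · exact funext fun d => sum_coeff_schurPoly n v hv d

end
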